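/- arXiv:1808.07957 — 6 statements merged into one kernel-verified Lean document; each statement's English description precedes it below -/
import Mathlib

section
/- Define steps : ℕ → ℕ → ℕ by steps x y = 1 if y ≤ 1, and steps x y = 1 + steps y (x % y) if y ≥ 2 (this recursion is well-founded since x % y < y when y ≥ 2). Then for all natural numbers x > y, the number of iterations of the Euclidean algorithm satisfies (steps x y : ℝ) ≤ Real.logb (3/2) (x + y) + 1. -/
def steps : ℕ → ℕ → ℕ
  | _, 0 => 1
  | _, 1 => 1
  | x, y + 2 => 1 + steps (y + 2) (x % (y + 2))
termination_by x y => y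
decreasing_by exact Nat.mod_lt _ (by omega)

theorem three_halves_pow_steps_le (x y : ℕ) (h : y < x) :
    (3 / 2 : ℝ) ^ steps x y ≤ 3 / 2 * (x + y) := by
  induction x, y using steps.induct with
  | case1 x =>
    have hx : (1 : ℝ) ≤ x := by exact_mod_cast h
    simp only [steps]
    push_cast
    linarith
  | case2 x =>
    have hx : (1 : ℝ) ≤ x := by exact_mod_cast h.le
    simp only [steps]
    push_cast
    linarith
  | case3 x y ih =>
    have hr : x % (y + 2) < y + 2 := Nat.mod_lt _ (by omega)
    have hx : y + 2 + x % (y + 2) ≤ x := by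
      have hq : 1 ≤ x / (y + 2) := Nat.div_pos h.le (by omega)
      have hle := Nat.mul_le_mul_left (y + 2) hq
      have hdiv := Nat.div_add_mod x (y + 2)
      omega
    have ih := ih hr
    rw [steps, pow_add, pow_one]
    have hr' : ((x % (y + 2) : ℕ) : ℝ) ≤ ((y + 2 : ℕ) : ℝ) := by exact_mod_cast hr.le
    have hx' : ((y + 2 : ℕ) : ℝ) + ((x % (y + 2) : ℕ) : ℝ) ≤ x := by exact_mod_cast hx
    linarith

theorem euclid_steps_le_logb (x y : ℕ) (h : x > y) :
    (steps x y : ℝ) ≤ Real.logb (3/2) (x + y) + 1 := by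
  have hpos : (0 : ℝ) < x + y := by
    have : 0 < x + y := by omega
    exact_mod_cast this
  have hlog := Real.logb_le_logb_of_le (b := 3 / 2) (by norm_num) (by positivity)
    (three_halves_pow_steps_le x y h)
  rw [Real.logb_pow, Real.logb_mul (by norm_num) hpos.ne',
    Real.logb_self_eq_one (by norm_num)] at hlog
  linarith
end

section
/- Define steps : ℕ → ℕ → ℕ by steps x y = 1 if y ≤ 1, and steps x y = 1 + steps y (x % y) if y ≥ 2 (this recursion is well-founded since x % y < y when y ≥ 2). Then for all natural numbers x > y, the number of iterations of the Euclidean algorithm satisfies (steps x y : ℝ) ≤ Real.logb φ (φ * x + y), where φ denotes the golden ratio (1 + √5)/2. -/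
open goldenRatio

theorem goldenRatio_pow_steps_le (x y : ℕ) (h : y < x) :
    φ ^ steps x y ≤ φ * x + y := by
  have hφ := Real.goldenRatio_pos
  fun_induction steps x y with
  | case1 x =>
    have hx : (1 : ℝ) ≤ x := by exact_mod_cast h
    push_cast
    nlinarith
  | case2 x =>
    have hx : (1 : ℝ) ≤ x := by exact_mod_cast h.le
    push_cast
    nlinarith
  | case3 x y ih =>
    have hr := ih (Nat.mod_lt _ (by omega))
    have hx : ((y + 2 : ℕ) : ℝ) + (x % (y + 2) : ℕ) ≤ x := by
      have hdiv : 1 ≤ x / (y + 2) := (Nat.one_le_div_iff (by omega)).2 h.le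
      have hmod := Nat.mod_add_div x (y + 2)
      exact_mod_cast (show y + 2 + x % (y + 2) ≤ x by nlinarith)
    calc φ ^ (1 + steps (y + 2) (x % (y + 2)))
        = φ * φ ^ steps (y + 2) (x % (y + 2)) := by rw [pow_add, pow_one]
      _ ≤ φ * (φ * (y + 2 : ℕ) + (x % (y + 2) : ℕ)) := by gcongr
      _ = φ * ((y + 2 : ℕ) + (x % (y + 2) : ℕ)) + (y + 2 : ℕ) := by
        linear_combination ((y + 2 : ℕ) : ℝ) * Real.goldenRatio_sq
      _ ≤ φ * x + (y + 2 : ℕ) := by gcongr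

theorem euclid_steps_le_logb_gold (x y : ℕ) (h : x > y) :
    (steps x y : ℝ) ≤ Real.logb φ (φ * x + y) := by
  have hpow := goldenRatio_pow_steps_le x y h
  have hpos : 0 < φ * x + y := (pow_pos Real.goldenRatio_pos _).trans_le hpow
  rwa [Real.le_logb_iff_rpow_le Real.one_lt_goldenRatio hpos, Real.rpow_natCast]
end

section
/- Let a > b be natural numbers, let m ≥ 1, and let x, y : ℕ → ℕ be sequences with x 1 = a, y 1 = b, and for every i with 1 ≤ i < m: y i ≥ 1, x (i+1) = y i, and y (i+1) = x i % y i. Define the potential s i = x i + y i. Then for every i with 1 ≤ i ≤ m, (s i : ℝ) ≤ (a + b) * (2/3)^(i-1). -/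
theorem three_mul_add_mod_le {x y : ℕ} (hy : 1 ≤ y) (hxy : y < x) :
    3 * (y + x % y) ≤ 2 * (x + y) := by
  have hmod : x % y < y := Nat.mod_lt x hy
  have hle : x % y + y ≤ x := by
    have hq : 1 ≤ x / y := Nat.div_pos hxy.le hy
    calc x % y + y ≤ x % y + y * (x / y) := by gcongr; exact Nat.le_mul_of_pos_right y hq
      _ = x := Nat.mod_add_div x y
  omega

theorem euclid_potential_decay (a b m : ℕ) (hab : a > b) (hm : 1 ≤ m)
    (x y : ℕ → ℕ) (hx1 : x 1 = a) (hy1 : y 1 = b)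
    (hstep : ∀ i, 1 ≤ i → i < m → 1 ≤ y i ∧ x (i + 1) = y i ∧ y (i + 1) = x i % y i)
    (s : ℕ → ℕ) (hs : ∀ i, s i = x i + y i) :
    ∀ i, 1 ≤ i → i ≤ m → (s i : ℝ) ≤ ((a : ℝ) + (b : ℝ)) * (2 / 3) ^ (i - 1) := by
  suffices h : ∀ i, 1 ≤ i → i ≤ m →
      y i < x i ∧ (s i : ℝ) ≤ ((a : ℝ) + (b : ℝ)) * (2 / 3) ^ (i - 1) from
    fun i hi him => (h i hi him).2
  intro i hi
  induction i, hi using Nat.le_induction with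
  | base => simp [hs, hx1, hy1, hab]
  | succ i hi ih =>
    intro him
    obtain ⟨hlt, hbound⟩ := ih (by omega)
    obtain ⟨hpos, hx, hy⟩ := hstep i hi him
    refine ⟨by rw [hx, hy]; exact Nat.mod_lt _ hpos, ?_⟩
    have hdecay : 3 * s (i + 1) ≤ 2 * s i := by
      rw [hs, hs, hx, hy]
      exact three_mul_add_mod_le hpos hlt
    have hdecay' : 3 * (s (i + 1) : ℝ) ≤ 2 * s i := by exact_mod_cast hdecay
    have hpow : (2 / 3 : ℝ) ^ (i + 1 - 1) = (2 / 3) ^ (i - 1) * (2 / 3) := by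
      rw [← pow_succ]
      congr 1
      omega
    rw [hpow, ← mul_assoc]
    linarith
end

section
/- For all natural numbers x and y with x > y ≥ 1, one has (y : ℝ) + (x % y : ℝ)/φ ≤ ((x : ℝ) + (y : ℝ)/φ)/φ, where φ denotes the golden ratio (1 + √5)/2. Equivalently, if a pair (x, y) with x > y ≥ 1 is replaced by (y, x mod y) in one step of the Euclidean algorithm, the potential s = x + y/φ decreases by a factor of at least φ. -/
open goldenRatio

theorem euclid_gold_potential_step (x y : ℕ) (hxy : x > y) (hy : y ≥ 1) :
    (y : ℝ) + (x % y : ℕ) / φ ≤ ((x : ℝ) + (y : ℝ) / φ) / φ := by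
  have hle : y + x % y ≤ x := by
    have hdiv : y * 1 ≤ y * (x / y) := Nat.mul_le_mul_left y (Nat.div_pos hxy.le hy)
    have hmod := Nat.div_add_mod x y
    omega
  have hle' : (y : ℝ) + (x % y : ℕ) ≤ x := mod_cast hle
  have hpos := Real.goldenRatio_pos
  calc (y : ℝ) + (x % y : ℕ) / φ
      = (((y : ℝ) + (x % y : ℕ)) + y / φ) / φ := by
        field_simp
        linear_combination 4 * (y : ℝ) * Real.goldenRatio_sq
    _ ≤ ((x : ℝ) + (y : ℝ) / φ) / φ := by gcongr
end

section
/- Let a > b be natural numbers, let m ≥ 1, and let x, y : ℕ → ℕ be sequences with x 1 = a, y 1 = b, and for every i with 1 ≤ i < m: y i ≥ 1, x (i+1) = y i, and y (i+1) = x i % y i. Define the improved potential s i = (x i : ℝ) + (y i : ℝ)/φ, where φ is the golden ratio. Then for every i with 1 ≤ i ≤ m, s i ≤ ((a : ℝ) + (b : ℝ)/φ) * (1/φ)^(i-1). -/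
open goldenRatio

theorem one_div_goldenRatio_sq_add_self : (1 / φ) ^ 2 + 1 / φ = 1 := by
  have h := Real.goldenRatio_sq
  have hinv : φ * (1 / φ) = 1 := mul_one_div_cancel Real.goldenRatio_ne_zero
  generalize 1 / φ = t at hinv ⊢
  linear_combination (-t ^ 2) * h + (φ * t + 1 - t) * hinv

/-- One Euclidean step shrinks the potential `u + v / φ` by a factor of at least `φ`. -/
theorem euclid_gold_potential_step_s7 {u v : ℕ} (hv : 1 ≤ v) (hvu : v < u) :
    (v : ℝ) + ((u % v : ℕ) : ℝ) / φ ≤ ((u : ℝ) + (v : ℝ) / φ) * (1 / φ) := by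
  have hle : v + u % v ≤ u := by
    have h1 := Nat.div_add_mod u v
    have h2 : v * 1 ≤ v * (u / v) := Nat.mul_le_mul_left v (Nat.div_pos hvu.le hv)
    lia
  have hle' : (v : ℝ) + ((u % v : ℕ) : ℝ) ≤ u := by exact_mod_cast hle
  have ht : 0 ≤ 1 / φ := by have := Real.goldenRatio_pos; positivity
  calc (v : ℝ) + ((u % v : ℕ) : ℝ) / φ
      = (v + ((u % v : ℕ) : ℝ)) * (1 / φ) + v * (1 / φ) ^ 2 := by
        linear_combination -(v : ℝ) * one_div_goldenRatio_sq_add_self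
    _ ≤ u * (1 / φ) + v * (1 / φ) ^ 2 := by gcongr
    _ = ((u : ℝ) + (v : ℝ) / φ) * (1 / φ) := by ring

theorem euclid_gold_potential_decay (a b m : ℕ) (hab : a > b) (hm : 1 ≤ m)
    (x y : ℕ → ℕ) (hx1 : x 1 = a) (hy1 : y 1 = b)
    (hstep : ∀ i, 1 ≤ i → i < m → 1 ≤ y i ∧ x (i + 1) = y i ∧ y (i + 1) = x i % y i)
    (s : ℕ → ℝ) (hs : ∀ i, s i = (x i : ℝ) + (y i : ℝ) / φ) :
    ∀ i, 1 ≤ i → i ≤ m → s i ≤ ((a : ℝ) + (b : ℝ) / φ) * (1 / φ) ^ (i - 1) := by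
  have ht : 0 ≤ 1 / φ := by have := Real.goldenRatio_pos; positivity
  suffices h : ∀ i, 1 ≤ i → i ≤ m →
      y i < x i ∧ s i ≤ ((a : ℝ) + (b : ℝ) / φ) * (1 / φ) ^ (i - 1) from
    fun i h1 h2 => (h i h1 h2).2
  intro i hi
  induction i, hi using Nat.le_induction with
  | base => intro _; simp [hs, hx1, hy1, hab]
  | succ k hk ih =>
    intro hkm
    obtain ⟨hlt, hle⟩ := ih (by lia)
    obtain ⟨hy, hx', hy'⟩ := hstep k hk hkm
    refine ⟨by rw [hx', hy']; exact Nat.mod_lt _ hy, ?_⟩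
    calc s (k + 1) ≤ s k * (1 / φ) := by
          rw [hs, hs, hx', hy']
          exact euclid_gold_potential_step_s7 hy hlt
      _ ≤ ((a : ℝ) + (b : ℝ) / φ) * (1 / φ) ^ (k - 1) * (1 / φ) := by gcongr
      _ = ((a : ℝ) + (b : ℝ) / φ) * (1 / φ) ^ (k + 1 - 1) := by
          rw [mul_assoc, ← pow_succ, Nat.sub_add_cancel hk, Nat.add_sub_cancel]
end

section
/- Let a > b be natural numbers, let m ≥ 1, and let x, y : ℕ → ℕ be sequences with x 1 = a, y 1 = b, and for every i with 1 ≤ i < m: y i ≥ 1, x (i+1) = y i, and y (i+1) = x i % y i. Define the improved potential s i = (x i : ℝ) + (y i : ℝ)/φ, where φ is the golden ratio. Then for every i with 2 ≤ i ≤ m, s i ≤ s (i-1) / φ. -/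
open goldenRatio

/-- One division step shrinks the golden potential `x + y / φ` by a factor of at least `φ`. -/
theorem golden_potential_mod_le {x y : ℕ} (hy : 1 ≤ y) (hyx : y ≤ x) :
    (y : ℝ) + ((x % y : ℕ) : ℝ) / φ ≤ ((x : ℝ) + (y : ℝ) / φ) / φ := by
  have hφ : 0 < φ := Real.goldenRatio_pos
  have hdiv : y + x % y ≤ x := by
    have hq : 1 ≤ x / y := Nat.div_pos hyx hy
    calc y + x % y ≤ y * (x / y) + x % y := by gcongr; exact Nat.le_mul_of_pos_right y hq
      _ = x := Nat.div_add_mod x y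
  have hcast : (y : ℝ) + ((x % y : ℕ) : ℝ) ≤ x := by exact_mod_cast hdiv
  have hone : 1 + 1 / φ = φ := by
    rw [one_div, Real.inv_goldenRatio]
    linarith only [Real.goldenRatio_add_goldenConj]
  rw [le_div_iff₀ hφ]
  calc ((y : ℝ) + ((x % y : ℕ) : ℝ) / φ) * φ = y * φ + ((x % y : ℕ) : ℝ) := by field_simp
    _ = y * (1 + 1 / φ) + ((x % y : ℕ) : ℝ) := by rw [hone]
    _ = (y + ((x % y : ℕ) : ℝ)) + y / φ := by ring
    _ ≤ x + y / φ := by gcongr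

theorem euclid_gold_potential_step_seq (a b m : ℕ) (hab : a > b) (hm : 1 ≤ m)
    (x y : ℕ → ℕ) (hx1 : x 1 = a) (hy1 : y 1 = b)
    (hstep : ∀ i, 1 ≤ i → i < m → 1 ≤ y i ∧ x (i + 1) = y i ∧ y (i + 1) = x i % y i)
    (s : ℕ → ℝ) (hs : ∀ i, s i = (x i : ℝ) + (y i : ℝ) / φ) :
    ∀ i, 2 ≤ i → i ≤ m → s i ≤ s (i - 1) / φ := by
  have hlt : ∀ i, 1 ≤ i → i ≤ m → y i < x i := by
    intro i hi
    induction i, hi using Nat.le_induction with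
    | base => intro _; rwa [hx1, hy1]
    | succ k hk _ =>
      intro hkm
      obtain ⟨hpos, hx, hy⟩ := hstep k hk hkm
      rw [hx, hy]
      exact Nat.mod_lt _ hpos
  intro i hi him
  obtain ⟨k, rfl⟩ : ∃ k, i = k + 1 := ⟨i - 1, by omega⟩
  have hk : 1 ≤ k := by omega
  obtain ⟨hpos, hx, hy⟩ := hstep k hk him
  rw [Nat.add_sub_cancel, hs, hs, hx, hy]
  exact golden_potential_mod_le hpos (hlt k hk (by omega)).le
end
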